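/- In the hidden-variable game with the locality loophole, Scientists A and B have a joint strategy (a rule determining, from the full history of all previous moves, Scientist A's bets {q_n^A(·|s) ∈ P(Ω)}_{s∈Θ^A} and setting s_n ∈ Θ^A, and, additionally given Nature A's current move ω_n^{s_n} ∈ Ω, Scientist B's bets {q_n^B(·|ω_n^{s_n}, s_n, t) ∈ P(Ω)}_{t∈Θ^B} and setting t_n ∈ Θ^B) under which every setting pair in Θ is chosen infinitely often, and such that for every play of Nature (every choice, at each round n, of ω_n^{s_n} ∈ Ω by Nature A and of λ_n ∈ X_{s_n}^{-1}({ω_n^{s_n}}) by Nature B, with ω_n^{t_n} := X_{t_n}(λ_n)), the following holds: either K_n^A → ∞, or K_n^B → ∞, or for all (s,t) ∈ Θ and all a,b ∈ Ω, #{i ≤ n : (ω_i^{s_i}, ω_i^{t_i}, s_i, t_i) = (a,b,s,t)} / #{i ≤ n : (s_i,t_i) = (s,t)} → p(a,b|s,t) as n → ∞. Here the capitals are K_0^A = K_0^B = 1, K_n^A = K_{n-1}^A · q_n^A(ω_n^{s_n}|s_n) / p(ω_n^{s_n}|s_n) and K_n^B = K_{n-1}^B · q_n^B(ω_n^{t_n}|ω_n^{s_n},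 s_n, t_n) / p(ω_n^{t_n}|ω_n^{s_n}, s_n, t_n). -/

import Mathlib

open Filter

/-- The two-point set `{+1, -1}` of measurement outcomes. -/
abbrev Sign := ({1, -1} : Finset ℤ)

/-- The set of joint measurement settings `Θ = {1,2} × {3,4}`. -/
def ThetaF : Finset (ℕ × ℕ) := ({1, 2} : Finset ℕ) ×ˢ ({3, 4} : Finset ℕ)

noncomputable def mu : ℝ := (2 - Real.sqrt 2) / 8
noncomputable def nu : ℝ := (2 + Real.sqrt 2) / 8

/-- The CHSH table `p(a,b|s,t)`. -/
noncomputable def chshP (a b : Sign) (s t : ℕ) : ℝ :=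
  if s = 1 ∧ t = 4 then (if a = b then nu else mu) else (if a = b then mu else nu)

/-- The full history of Nature's moves in the first `m` rounds: the list of pairs
`(ω_i^{s_i}, λ_i)` for `i = 1, …, m` (all other moves in a round are determined
from these by the players' strategies). -/
def hist2 {Λ : Type*} (ωA : ℕ → Sign) (lam : ℕ → Λ) (m : ℕ) : List (Sign × Λ) :=
  (List.range m).map fun i => (ωA (i + 1), lam (i + 1))

open Topology

section WeightedAverage

/-- A bounded sequence whose steps are controlled by weights `w` of divergent sum and summable
squares tends to zero as soon as `∑ w y²` converges. -/
theorem tendsto_zero_of_summable_weight_mul_sq {w y : ℕ → ℝ}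
    (hw0 : ∀ n, 0 ≤ w n) (hw1 : ∀ n, w n ≤ 1) (hy : ∀ n, |y n| ≤ 1)
    (hstep : ∀ n, |y (n + 1) - y n| ≤ 2 * w n)
    (hsq : Summable fun n => w n ^ 2) (hen : Summable fun n => w n * y n ^ 2)
    (hw : ¬ Summable w) : Tendsto y atTop (𝓝 0) := by
  have hdist : ∀ n, dist (y n ^ 3) (y (n + 1) ^ 3) ≤ 9 * (w n * y n ^ 2) + 24 * w n ^ 2 := by
    intro n
    have hΔ : (y (n + 1) - y n) ^ 2 ≤ (2 * w n) ^ 2 := sq_le_sq.mpr (by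
      rw [abs_of_nonneg (a := 2 * w n) (by linarith [hw0 n])]
      exact hstep n)
    have hquad : y (n + 1) ^ 2 + y (n + 1) * y n + y n ^ 2
        ≤ 9 / 2 * y n ^ 2 + 3 * (y (n + 1) - y n) ^ 2 := by
      nlinarith [sq_nonneg (y (n + 1) - y n), sq_nonneg (y (n + 1) - 2 * y n)]
    have hquad0 : 0 ≤ y (n + 1) ^ 2 + y (n + 1) * y n + y n ^ 2 := by
      nlinarith [sq_nonneg (y (n + 1) + y n), sq_nonneg (y (n + 1)), sq_nonneg (y n)]
    have hcube : w n ^ 3 ≤ w n ^ 2 := pow_le_pow_of_le_one (hw0 n) (hw1 n) (by norm_num)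
    calc dist (y n ^ 3) (y (n + 1) ^ 3)
        = |y (n + 1) - y n| * (y (n + 1) ^ 2 + y (n + 1) * y n + y n ^ 2) := by
          rw [dist_comm, Real.dist_eq, ← abs_of_nonneg (a := _ + _ + y n ^ 2) hquad0, ← abs_mul]
          ring_nf
      _ ≤ 2 * w n * (9 / 2 * y n ^ 2 + 3 * (2 * w n) ^ 2) := by
          apply mul_le_mul (hstep n) (by linarith) hquad0 (by linarith [hw0 n])
      _ ≤ 9 * (w n * y n ^ 2) + 24 * w n ^ 2 := by nlinarith
  have hcauchy : CauchySeq fun n => y n ^ 3 :=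
    cauchySeq_of_dist_le_of_summable _ hdist ((hen.mul_left 9).add (hsq.mul_left 24))
  obtain ⟨l, hl⟩ := cauchySeq_tendsto_of_complete hcauchy
  have hl0 : l = 0 := by
    by_contra hne
    have hpos : 0 < |l| / 2 := by positivity
    have hev : ∀ᶠ n in atTop, |l| / 2 < |y n ^ 3| :=
      hl.abs.eventually_const_lt (by linarith [abs_pos.mpr hne])
    refine hw (Summable.of_norm_bounded_eventually_nat
      (g := fun n => (|l| / 2)⁻¹ * (w n * y n ^ 2)) (hen.mul_left _) ?_)
    filter_upwards [hev] with n hn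
    have hle : |y n ^ 3| ≤ y n ^ 2 := by
      rw [abs_pow, ← sq_abs (y n)]
      exact pow_le_pow_of_le_one (abs_nonneg _) (hy n) (by norm_num)
    rw [Real.norm_of_nonneg (hw0 n), inv_mul_eq_div, le_div_iff₀ hpos]
    exact mul_le_mul_of_nonneg_left (by linarith) (hw0 n)
  subst hl0
  rw [Metric.tendsto_atTop] at hl ⊢
  intro ε hε
  obtain ⟨N, hN⟩ := hl (ε ^ 3) (by positivity)
  refine ⟨N, fun n hn => ?_⟩
  have h := hN n hn
  rw [Real.dist_eq, sub_zero] at h ⊢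
  rw [abs_pow] at h
  exact lt_of_pow_lt_pow_left₀ 3 hε.le h

end WeightedAverage

section BettingGame

theorem abs_le_one_of_mem_record {J : Type*} {e : ℕ → J × ℝ} {E : ℕ → List (J × ℝ)}
    (hE0 : E 0 = []) (hE : ∀ n, E (n + 1) = e (n + 1) :: E n)
    (he : ∀ n, |(e n).2| ≤ 1) (n : ℕ) :
    ∀ d ∈ E n, |d.2| ≤ 1 := by
  induction n with
  | zero => simp [hE0]
  | succ n ih =>
    rw [hE]
    rintro d (_ | ⟨_, hd⟩)
    · exact he _
    · exact ih d hd

variable {J : Type*} [DecidableEq J]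

/-- The number of rounds of class `j`; records of a play list the most recent round first. -/
def visits (j : J) : List (J × ℝ) → ℕ
  | [] => 0
  | e :: L => visits j L + if e.1 = j then 1 else 0

/-- The weight that the round `e`, played after `L`, has in the running mean of class `j`. -/
noncomputable def weight (j : J) (e : J × ℝ) (L : List (J × ℝ)) : ℝ :=
  if e.1 = j then 1 / (visits j L + 1) else 0

/-- The mean of the outcomes in the rounds of class `j`. -/
noncomputable def runningMean (j : J) : List (J × ℝ) → ℝ
  | [] => 0
  | e :: L => runningMean j L + weight j e L * (e.2 - runningMean j L)

/-- The accumulated weighted squares of the running means of class `j`. -/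
noncomputable def energy (j : J) : List (J × ℝ) → ℝ
  | [] => 0
  | e :: L => energy j L + weight j e L * runningMean j L ^ 2

/-- The accumulated squared weights of class `j`. -/
noncomputable def sqWeight (j : J) : List (J × ℝ) → ℝ
  | [] => 0
  | e :: L => sqWeight j L + weight j e L ^ 2

/-- The amount staked on the outcome of a round of class `j` played after `L`. -/
noncomputable def stake (j : J) (L : List (J × ℝ)) : ℝ :=
  2 * (1 / (visits j L + 1)) * (1 - 1 / (visits j L + 1)) * runningMean j L

/-- The capital of the gambler who plays the stakes `stake`. -/
noncomputable def capital [Fintype J] : List (J × ℝ) → ℝ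
  | [] => 2 * Fintype.card J + 1
  | e :: L => capital L + stake e.1 L * e.2

theorem weight_nonneg (j : J) (e : J × ℝ) (L : List (J × ℝ)) : 0 ≤ weight j e L := by
  unfold weight
  split_ifs <;> positivity

theorem weight_le_one (j : J) (e : J × ℝ) (L : List (J × ℝ)) : weight j e L ≤ 1 := by
  unfold weight
  split_ifs
  · rw [div_le_one (by positivity)]
    linarith [(visits j L).cast_nonneg (α := ℝ)]
  · norm_num

theorem energy_nonneg (j : J) (L : List (J × ℝ)) : 0 ≤ energy j L := by
  induction L with
  | nil => exact le_rfl
  | cons e L ih =>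
    have := mul_nonneg (weight_nonneg j e L) (sq_nonneg (runningMean j L))
    simp only [energy]
    linarith

theorem sqWeight_le (j : J) (L : List (J × ℝ)) : sqWeight j L ≤ 2 - 1 / (visits j L : ℝ) := by
  induction L with
  | nil => simp [sqWeight, visits]
  | cons e L ih =>
    by_cases h : e.1 = j
    · simp only [sqWeight, visits, weight, h, if_true, Nat.cast_add, Nat.cast_one]
      rcases Nat.eq_zero_or_pos (visits j L) with h0 | h0
      · have : sqWeight j L = 0 := by
          clear ih
          induction L with
          | nil => rfl
          | cons e' L ih' =>
            by_cases h' : e'.1 = j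
            · simp [visits, h'] at h0
            · simp only [visits, h', if_false, add_zero] at h0
              simp [sqWeight, weight, h', ih' h0]
        rw [this, h0]
        norm_num
      · have hv : (0 : ℝ) < visits j L := by exact_mod_cast h0
        have : (1 / ((visits j L : ℝ) + 1)) ^ 2
            ≤ 1 / (visits j L : ℝ) - 1 / ((visits j L : ℝ) + 1) := by
          rw [div_sub_div _ _ hv.ne' (by positivity), div_pow, div_le_div_iff₀ (by positivity)
            (by positivity)]
          nlinarith
        linarith
    · simpa [sqWeight, visits, weight, h] using ih

theorem sqWeight_le_two (j : J) (L : List (J × ℝ)) : sqWeight j L ≤ 2 := by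
  have h := sqWeight_le j L
  have : 0 ≤ 1 / (visits j L : ℝ) := by positivity
  linarith

theorem abs_runningMean_le_one (j : J) {L : List (J × ℝ)} (hL : ∀ e ∈ L, |e.2| ≤ 1) :
    |runningMean j L| ≤ 1 := by
  induction L with
  | nil => simp [runningMean]
  | cons e L ih =>
    have h1 := abs_le.mp (ih fun e' he' => hL e' (List.mem_cons_of_mem _ he'))
    have h2 := abs_le.mp (hL e List.mem_cons_self)
    have hw0 := weight_nonneg j e L
    have hw1 := weight_le_one j e L
    simp only [runningMean]
    rw [abs_le]
    constructor <;> nlinarith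

theorem one_add_sum_energy_le_capital [Fintype J] {L : List (J × ℝ)} (hL : ∀ e ∈ L, |e.2| ≤ 1) :
    1 + ∑ j, energy j L ≤ capital L := by
  suffices h : 2 * Fintype.card J + 1 + ∑ j, (runningMean j L ^ 2 + energy j L - sqWeight j L)
      ≤ capital L by
    have h2 : ∑ j, (energy j L - 2)
        ≤ ∑ j, (runningMean j L ^ 2 + energy j L - sqWeight j L) :=
      Finset.sum_le_sum fun j _ => by
        linarith [sqWeight_le_two j L, sq_nonneg (runningMean j L)]
    rw [Finset.sum_sub_distrib, Finset.sum_const, Finset.card_univ, nsmul_eq_mul] at h2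
    linarith
  induction L with
  | nil => simp [runningMean, energy, sqWeight, capital]
  | cons e L ih =>
    specialize ih fun e' he' => hL e' (List.mem_cons_of_mem _ he')
    have hx := sq_le_one_iff_abs_le_one e.2 |>.mpr (hL e List.mem_cons_self)
    have hsum : ∑ j, ((runningMean j (e :: L) ^ 2 + energy j (e :: L) - sqWeight j (e :: L))
        - (runningMean j L ^ 2 + energy j L - sqWeight j L)) ≤ stake e.1 L * e.2 := by
      rw [Finset.sum_eq_single e.1]
      · have hw0 := weight_nonneg e.1 e L
        have hw1 := weight_le_one e.1 e L
        have hs : stake e.1 L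
            = 2 * weight e.1 e L * (1 - weight e.1 e L) * runningMean e.1 L := by
          simp [stake, weight]
        simp only [runningMean, energy, sqWeight, hs]
        nlinarith [mul_nonneg (mul_nonneg hw0 (sub_nonneg.mpr hw1))
          (sq_nonneg (runningMean e.1 L)), mul_nonneg (sq_nonneg (weight e.1 e L))
          (sub_nonneg.mpr hx)]
      · intro j _ hj
        simp [runningMean, energy, sqWeight, weight, hj.symm]
      · simp
    rw [Finset.sum_sub_distrib] at hsum
    simp only [capital]
    linarith

theorem capital_pos [Fintype J] {L : List (J × ℝ)} (hL : ∀ e ∈ L, |e.2| ≤ 1) :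
    0 < capital L := by
  have h1 := one_add_sum_energy_le_capital hL
  have h2 : 0 ≤ ∑ j, energy j L := Finset.sum_nonneg fun j _ => energy_nonneg j L
  linarith

variable {e : ℕ → J × ℝ} {E : ℕ → List (J × ℝ)}

theorem not_summable_weight (hE0 : E 0 = []) (hE : ∀ n, E (n + 1) = e (n + 1) :: E n) (j : J)
    (hj : Tendsto (fun n => visits j (E n)) atTop atTop) :
    ¬ Summable fun n => weight j (e (n + 1)) (E n) := by
  have hlog : ∀ n, Real.log (visits j (E n) + 1)
      ≤ ∑ i ∈ Finset.range n, weight j (e (i + 1)) (E i) := by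
    intro n
    induction n with
    | zero => simp [hE0, visits]
    | succ n ih =>
      rw [Finset.sum_range_succ, hE]
      by_cases h : (e (n + 1)).1 = j
      · have hw : weight j (e (n + 1)) (E n) = 1 / (visits j (E n) + 1) := if_pos h
        simp only [visits, hw, h, if_true, Nat.cast_add, Nat.cast_one]
        have hv : (0 : ℝ) < visits j (E n) + 1 := by positivity
        have hl := Real.log_le_sub_one_of_pos
          (x := ((visits j (E n) : ℝ) + 1 + 1) / (visits j (E n) + 1)) (by positivity)
        rw [Real.log_div (by positivity) hv.ne', add_div, div_self hv.ne'] at hl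
        linarith
      · have hw : weight j (e (n + 1)) (E n) = 0 := if_neg h
        simpa [visits, hw, h] using ih
  rw [not_summable_iff_tendsto_nat_atTop_of_nonneg fun n => weight_nonneg _ _ _]
  refine tendsto_atTop_mono hlog (Real.tendsto_log_atTop.comp ?_)
  exact tendsto_atTop_add_const_right _ _ (tendsto_natCast_atTop_atTop.comp hj)

theorem capital_tendsto_atTop_or_runningMean_tendsto_zero [Fintype J] (hE0 : E 0 = [])
    (hE : ∀ n, E (n + 1) = e (n + 1) :: E n) (he : ∀ n, |(e n).2| ≤ 1) :
    Tendsto (fun n => capital (E n)) atTop atTop ∨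
      ∀ j, Tendsto (fun n => visits j (E n)) atTop atTop →
        Tendsto (fun n => runningMean j (E n)) atTop (𝓝 0) := by
  have hmem := abs_le_one_of_mem_record hE0 hE he
  rw [or_iff_not_imp_left]
  intro hcap j hj
  have henergy : ∀ n, energy j (E n)
      = ∑ i ∈ Finset.range n, weight j (e (i + 1)) (E i) * runningMean j (E i) ^ 2 := by
    intro n
    induction n with
    | zero => simp [hE0, energy]
    | succ n ih => rw [Finset.sum_range_succ, hE, energy, ih]
  have hsqWeight : ∀ n, sqWeight j (E n)
      = ∑ i ∈ Finset.range n, weight j (e (i + 1)) (E i) ^ 2 := by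
    intro n
    induction n with
    | zero => simp [hE0, sqWeight]
    | succ n ih => rw [Finset.sum_range_succ, hE, sqWeight, ih]
  refine tendsto_zero_of_summable_weight_mul_sq (w := fun n => weight j (e (n + 1)) (E n))
    (fun n => weight_nonneg _ _ _) (fun n => weight_le_one _ _ _)
    (fun n => abs_runningMean_le_one j (hmem n)) (fun n => ?_) ?_ ?_
    (not_summable_weight hE0 hE j hj)
  · have h1 := abs_le.mp (abs_runningMean_le_one j (hmem n))
    have h2 := abs_le.mp (he (n + 1))
    have hw0 := weight_nonneg j (e (n + 1)) (E n)
    rw [hE, runningMean, add_sub_cancel_left, abs_le]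
    constructor <;> nlinarith
  · exact summable_of_sum_range_le (c := 2) (fun n => sq_nonneg _) fun n => by
      rw [← hsqWeight]
      exact sqWeight_le_two j _
  · by_contra hns
    rw [not_summable_iff_tendsto_nat_atTop_of_nonneg
      fun n => mul_nonneg (weight_nonneg _ _ _) (sq_nonneg _)] at hns
    refine hcap (tendsto_atTop_mono (fun n => ?_) hns)
    rw [← henergy]
    have h1 := one_add_sum_energy_le_capital (hmem n)
    have h2 := Finset.single_le_sum (f := fun j => energy j (E n))
      (fun j _ => energy_nonneg j (E n)) (Finset.mem_univ j)
    linarith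

theorem visits_eq_card (hE0 : E 0 = []) (hE : ∀ n, E (n + 1) = e (n + 1) :: E n) (j : J)
    (n : ℕ) : visits j (E n) = ((Finset.Icc 1 n).filter fun i => (e i).1 = j).card := by
  rw [Finset.card_filter]
  induction n with
  | zero => simp [hE0, visits]
  | succ n ih => rw [hE, visits, ih, Finset.sum_Icc_succ_top (by omega)]

theorem runningMean_mul_visits (hE0 : E 0 = []) (hE : ∀ n, E (n + 1) = e (n + 1) :: E n) (j : J)
    (n : ℕ) : runningMean j (E n) * visits j (E n)
      = ∑ i ∈ Finset.Icc 1 n, if (e i).1 = j then (e i).2 else 0 := by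
  induction n with
  | zero => simp [hE0, visits]
  | succ n ih =>
    rw [Finset.sum_Icc_succ_top (by omega), ← ih, hE]
    by_cases h : (e (n + 1)).1 = j
    · simp only [visits, runningMean, weight, h, if_true, Nat.cast_add, Nat.cast_one]
      field_simp
      ring
    · simp [visits, runningMean, weight, h]

end BettingGame

section SignForecasting

def plusSign : Sign := ⟨1, by simp⟩

def minusSign : Sign := ⟨-1, by simp⟩

theorem eq_plusSign_or_eq_minusSign (a : Sign) : a = plusSign ∨ a = minusSign := by
  revert a
  decide

theorem minusSign_ne_plusSign : minusSign ≠ plusSign := by decide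

theorem sum_sign (f : Sign → ℝ) : ∑ a : Sign, f a = f plusSign + f minusSign := by
  have h : (Finset.univ : Finset Sign) = {plusSign, minusSign} := by decide
  rw [h, Finset.sum_pair minusSign_ne_plusSign.symm]

variable {J : Type*}

/-- The forecasts `p j` are probability measures on `Sign` with full support. -/
def IsForecast (p : J → Sign → ℝ) : Prop :=
  ∀ j, (∀ a, 0 < p j a) ∧ p j plusSign + p j minusSign = 1

/-- The record of a round of class `j` with outcome `a`: the class and the centred indicator of
the outcome `+1`. -/
noncomputable def roundRecord (p : J → Sign → ℝ) (j : J) (a : Sign) : J × ℝ :=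
  (j, (if a = plusSign then 1 else 0) - p j plusSign)

theorem IsForecast.abs_roundRecord_le_one {p : J → Sign → ℝ} (hp : IsForecast p) (j : J) (a : Sign) :
    |(roundRecord p j a).2| ≤ 1 := by
  have h1 := (hp j).1 plusSign
  have h2 := (hp j).1 minusSign
  have h3 := (hp j).2
  rw [roundRecord, abs_le]
  dsimp only
  split_ifs <;> constructor <;> linarith

variable [DecidableEq J] [Fintype J]

/-- The bet on outcome `a` of a round of class `j` played after `L`. -/
noncomputable def bet (p : J → Sign → ℝ) (j : J) (L : List (J × ℝ)) (a : Sign) : ℝ :=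
  p j a * (capital (roundRecord p j a :: L) / capital L)

theorem IsForecast.bet_pos {p : J → Sign → ℝ} (hp : IsForecast p) (j : J) {L : List (J × ℝ)}
    (hL : ∀ e ∈ L, |e.2| ≤ 1) (a : Sign) : 0 < bet p j L a := by
  refine mul_pos ((hp j).1 a) (div_pos (capital_pos ?_) (capital_pos hL))
  rintro d (_ | ⟨_, hd⟩)
  · exact hp.abs_roundRecord_le_one j a
  · exact hL d hd

theorem IsForecast.sum_bet {p : J → Sign → ℝ} (hp : IsForecast p) (j : J) {L : List (J × ℝ)}
    (hL : ∀ e ∈ L, |e.2| ≤ 1) : ∑ a : Sign, bet p j L a = 1 := by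
  have hc := (capital_pos hL).ne'
  have h : p j minusSign = 1 - p j plusSign := by linarith [(hp j).2]
  rw [sum_sign]
  simp only [bet, capital, roundRecord, minusSign_ne_plusSign, if_true, if_false, h]
  field_simp
  ring

theorem IsForecast.bet_mem_Ioo_and_sum_bet {p : J → Sign → ℝ} (hp : IsForecast p) (j : J)
    {L : List (J × ℝ)} (hL : ∀ e ∈ L, |e.2| ≤ 1) :
    (∀ a, bet p j L a ∈ Set.Ioo (0 : ℝ) 1) ∧ ∑ a : Sign, bet p j L a = 1 := by
  have hs := hp.sum_bet j hL
  refine ⟨fun a => ⟨hp.bet_pos j hL a, ?_⟩, hs⟩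
  have h1 := hp.bet_pos j hL plusSign
  have h2 := hp.bet_pos j hL minusSign
  rw [sum_sign] at hs
  rcases eq_plusSign_or_eq_minusSign a with rfl | rfl <;> linarith

variable {p : J → Sign → ℝ} {c : ℕ → J} {z : ℕ → Sign} {E : ℕ → List (J × ℝ)}

theorem IsForecast.capital_tendsto_of_bet (hp : IsForecast p) (hE0 : E 0 = [])
    (hE : ∀ n, E (n + 1) = roundRecord p (c (n + 1)) (z (n + 1)) :: E n) {K : ℕ → ℝ} (hK0 : K 0 = 1)
    (hK : ∀ n, K (n + 1)
      = K n * bet p (c (n + 1)) (E n) (z (n + 1)) / p (c (n + 1)) (z (n + 1)))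
    (h : Tendsto (fun n => capital (E n)) atTop atTop) : Tendsto K atTop atTop := by
  have hpos : ∀ n, 0 < capital (E n) := fun n =>
    capital_pos (abs_le_one_of_mem_record (e := fun n => roundRecord p (c n) (z n)) hE0 hE
      (fun n => hp.abs_roundRecord_le_one _ _) n)
  have hKeq : ∀ n, K n = capital (E n) / capital (E 0) := by
    intro n
    induction n with
    | zero => rw [hK0, div_self (hpos 0).ne']
    | succ n ih =>
      have h1 := (hpos n).ne'
      have h2 := (hpos 0).ne'
      have h3 := ((hp (c (n + 1))).1 (z (n + 1))).ne'
      rw [hK, ih, bet, ← hE]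
      field_simp
  rw [funext hKeq]
  exact h.atTop_div_const (hpos 0)

theorem IsForecast.capital_tendsto_atTop_or_frequency_tendsto (hp : IsForecast p) (hE0 : E 0 = [])
    (hE : ∀ n, E (n + 1) = roundRecord p (c (n + 1)) (z (n + 1)) :: E n) :
    Tendsto (fun n => capital (E n)) atTop atTop ∨
      ∀ j, Tendsto (fun n => ((Finset.Icc 1 n).filter fun i => c i = j).card) atTop atTop →
        ∀ a, Tendsto (fun n => (((Finset.Icc 1 n).filter fun i => c i = j ∧ z i = a).card : ℝ) /
          ((Finset.Icc 1 n).filter fun i => c i = j).card) atTop (𝓝 (p j a)) := by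
  refine (capital_tendsto_atTop_or_runningMean_tendsto_zero
    (e := fun n => roundRecord p (c n) (z n)) hE0 hE fun n => hp.abs_roundRecord_le_one _ _).imp_right ?_
  intro h j hj
  have hvis : ∀ n, visits j (E n) = ((Finset.Icc 1 n).filter fun i => c i = j).card :=
    visits_eq_card (e := fun n => roundRecord p (c n) (z n)) hE0 hE j
  have hmean := runningMean_mul_visits (e := fun n => roundRecord p (c n) (z n)) hE0 hE j
  simp only [roundRecord] at hmean
  have hcard : ∀ n, (((Finset.Icc 1 n).filter fun i => c i = j ∧ z i = plusSign).card : ℝ)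
      = (runningMean j (E n) + p j plusSign)
        * ((Finset.Icc 1 n).filter fun i => c i = j).card := by
    intro n
    rw [add_mul, ← hvis, hmean, hvis, Finset.card_filter, Finset.card_filter]
    push_cast
    rw [Finset.mul_sum, ← Finset.sum_add_distrib]
    refine Finset.sum_congr rfl fun i _ => ?_
    by_cases h1 : c i = j <;> by_cases h2 : z i = plusSign <;> simp [h1, h2]
  have hsplit : ∀ n, (((Finset.Icc 1 n).filter fun i => c i = j ∧ z i = minusSign).card : ℝ)
      = ((Finset.Icc 1 n).filter fun i => c i = j).card
        - ((Finset.Icc 1 n).filter fun i => c i = j ∧ z i = plusSign).card := by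
    intro n
    simp only [Finset.card_filter]
    push_cast
    rw [← Finset.sum_sub_distrib]
    refine Finset.sum_congr rfl fun i _ => ?_
    rcases eq_plusSign_or_eq_minusSign (z i) with h2 | h2 <;> by_cases h1 : c i = j <;>
      simp [h1, h2, minusSign_ne_plusSign, minusSign_ne_plusSign.symm]
  have hm := h j (by simpa only [hvis] using hj)
  have hpos : ∀ᶠ n in atTop, (0 : ℝ) < ((Finset.Icc 1 n).filter fun i => c i = j).card := by
    filter_upwards [hj.eventually_gt_atTop 0] with n hn
    exact_mod_cast hn
  intro a
  rcases eq_plusSign_or_eq_minusSign a with rfl | rfl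
  · have hlim := hm.add_const (p j plusSign)
    rw [zero_add] at hlim
    refine hlim.congr' ?_
    filter_upwards [hpos] with n hn
    rw [hcard, mul_div_cancel_right₀ _ hn.ne']
  · have hlim := (hm.add_const (p j plusSign)).const_sub 1
    rw [zero_add, show 1 - p j plusSign = p j minusSign by linarith [(hp j).2]] at hlim
    refine hlim.congr' ?_
    filter_upwards [hpos] with n hn
    rw [hsplit, hcard, sub_div, mul_div_cancel_right₀ _ hn.ne', div_self hn.ne']

end SignForecasting

section Chsh

/-- The settings of Scientist A and Scientist B in the four phases of their common cycle. -/
def settingA : Fin 4 → ℕ := ![1, 1, 2, 2]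

def settingB : Fin 4 → ℕ := ![3, 4, 3, 4]

def phase (n : ℕ) : Fin 4 := Fin.ofNat 4 n

theorem settings_eq_iff (i j : Fin 4) :
    (settingA i, settingB i) = (settingA j, settingB j) ↔ i = j := by
  revert i j
  decide

theorem exists_settings_eq {st : ℕ × ℕ} (h : st ∈ ThetaF) :
    ∃ j, st = (settingA j, settingB j) := by
  revert st
  decide

theorem settingA_mem (j : Fin 4) : settingA j ∈ ({1, 2} : Finset ℕ) := by
  revert j
  decide

theorem settingB_mem (j : Fin 4) : settingB j ∈ ({3, 4} : Finset ℕ) := by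
  revert j
  decide

theorem exists_phase_eq (j : Fin 4) (N : ℕ) : ∃ n ≥ N, phase n = j := by
  refine ⟨4 * N + j, by omega, ?_⟩
  ext
  simp [phase]

theorem chshP_pos (a b : Sign) (s t : ℕ) : 0 < chshP a b s t := by
  have h : Real.sqrt 2 < 2 := by
    rw [Real.sqrt_lt' (by norm_num)]
    norm_num
  have h0 := Real.sqrt_nonneg 2
  unfold chshP mu nu
  split_ifs <;> linarith

/-- The forecasts for Nature A. -/
noncomputable def forecastA : Fin 4 → Sign → ℝ := fun _ _ => 1 / 2

/-- The forecasts for Nature B, given the phase and the outcome of Nature A. -/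
noncomputable def forecastB : Fin 4 × Sign → Sign → ℝ :=
  fun j b => 2 * chshP j.2 b (settingA j.1) (settingB j.1)

theorem isForecast_forecastA : IsForecast forecastA := by
  intro j
  norm_num [forecastA]

theorem isForecast_forecastB : IsForecast forecastB := by
  rintro ⟨j, a⟩
  refine ⟨fun b => mul_pos two_pos (chshP_pos _ _ _ _), ?_⟩
  rcases eq_plusSign_or_eq_minusSign a with rfl | rfl <;>
    simp only [forecastB, chshP, minusSign_ne_plusSign, minusSign_ne_plusSign.symm, mu, nu,
      if_true, if_false] <;> split_ifs <;> ring

variable {Λ : Type*}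

/-- The rounds of Scientist A's game, from Nature's moves listed with the most recent one first. -/
noncomputable def recordA : List (Sign × Λ) → List (Fin 4 × ℝ)
  | [] => []
  | d :: h => roundRecord forecastA (phase h.length) d.1 :: recordA h

/-- The rounds of Scientist B's game, from Nature's moves listed with the most recent one first. -/
noncomputable def recordB (X : ℕ → Λ → Sign) : List (Sign × Λ) → List ((Fin 4 × Sign) × ℝ)
  | [] => []
  | d :: h => roundRecord forecastB (phase h.length, d.1) (X (settingB (phase h.length)) d.2)
      :: recordB X h

theorem abs_le_one_of_mem_recordA (h : List (Sign × Λ)) : ∀ e ∈ recordA h, |e.2| ≤ 1 := by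
  induction h with
  | nil => simp [recordA]
  | cons d h ih =>
    rintro e (_ | ⟨_, he⟩)
    · exact isForecast_forecastA.abs_roundRecord_le_one _ _
    · exact ih e he

theorem abs_le_one_of_mem_recordB (X : ℕ → Λ → Sign) (h : List (Sign × Λ)) :
    ∀ e ∈ recordB X h, |e.2| ≤ 1 := by
  induction h with
  | nil => simp [recordB]
  | cons d h ih =>
    rintro e (_ | ⟨_, he⟩)
    · exact isForecast_forecastB.abs_roundRecord_le_one _ _
    · exact ih e he

theorem reverse_hist2_succ (ωA : ℕ → Sign) (lam : ℕ → Λ) (m : ℕ) :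
    (hist2 ωA lam (m + 1)).reverse = (ωA (m + 1), lam (m + 1)) :: (hist2 ωA lam m).reverse := by
  simp [hist2, List.range_succ]

theorem length_hist2 (ωA : ℕ → Sign) (lam : ℕ → Λ) (m : ℕ) : (hist2 ωA lam m).length = m := by
  simp [hist2]

theorem tendsto_card_filter_atTop {q : ℕ → Prop} [DecidablePred q]
    (hq : ∀ N, ∃ n ≥ N, q (n + 1)) :
    Tendsto (fun n => ((Finset.Icc 1 n).filter q).card) atTop atTop := by
  refine tendsto_atTop_atTop_of_monotone
    (fun m n hmn => Finset.card_le_card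
      (Finset.filter_subset_filter _ (Finset.Icc_subset_Icc_right hmn))) fun k => ?_
  induction k with
  | zero => exact ⟨0, Nat.zero_le _⟩
  | succ k ih =>
    obtain ⟨N, hN⟩ := ih
    obtain ⟨n, hn, hqn⟩ := hq N
    refine ⟨n + 1, ?_⟩
    have hlt : (Finset.Icc 1 N).filter q ⊂ (Finset.Icc 1 (n + 1)).filter q := by
      rw [Finset.ssubset_iff_of_subset
        (Finset.filter_subset_filter _ (Finset.Icc_subset_Icc_right (by omega)))]
      exact ⟨n + 1, by simp [hqn], by simp; omega⟩
    have := Finset.card_lt_card hlt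
    omega

end Chsh

/-- **Forcing the CHSH table in the hidden-variable game with the locality loophole.**
Scientists A and B have a joint strategy — `stratA` giving A's bets
`{qₙᴬ(·|s)}_{s∈Θᴬ}` and setting `sₙ ∈ Θᴬ` from the history, and `stratB` giving,
additionally from Nature A's current move `ωₙ^{sₙ}`, B's bets
`{qₙᴮ(·|ωₙ^{sₙ},sₙ,t)}_{t∈Θᴮ}` and setting `tₙ ∈ Θᴮ` — choosing every setting
pair infinitely often, such that for every play of Nature (any `ωₙ^{sₙ} ∈ Ω` and
any `λₙ ∈ X_{sₙ}⁻¹({ωₙ^{sₙ}})`, with `ωₙ^{tₙ} := X_{tₙ}(λₙ)`): either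
`Kₙᴬ → ∞`, or `Kₙᴮ → ∞`, or all conditional empirical frequencies converge to
the CHSH table.  Here `p(a|s) = 1/2` and `p(b|a,s,t) = 2·p(a,b|s,t)`. -/
theorem locality_loophole_game_forcing
    {Λ : Type*} (X : ℕ → Λ → Sign)
    (hsurj : Function.Surjective fun l : Λ => (X 1 l, X 2 l, X 3 l, X 4 l)) :
    ∃ stratA : List (Sign × Λ) → (ℕ → Sign → ℝ) × ℕ,
      ∃ stratB : List (Sign × Λ) → Sign → (ℕ → Sign → ℝ) × ℕ,
      (∀ h, (stratA h).2 ∈ ({1, 2} : Finset ℕ) ∧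
        ∀ s ∈ ({1, 2} : Finset ℕ),
          (∀ a : Sign, (stratA h).1 s a ∈ Set.Ioo (0 : ℝ) 1) ∧
          ∑ a : Sign, (stratA h).1 s a = 1) ∧
      (∀ h ω, (stratB h ω).2 ∈ ({3, 4} : Finset ℕ) ∧
        ∀ t ∈ ({3, 4} : Finset ℕ),
          (∀ b : Sign, (stratB h ω).1 t b ∈ Set.Ioo (0 : ℝ) 1) ∧
          ∑ b : Sign, (stratB h ω).1 t b = 1) ∧
      ∀ (ωA : ℕ → Sign) (lam : ℕ → Λ) (sseq tseq : ℕ → ℕ) (ωB : ℕ → Sign),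
        (∀ n, 1 ≤ n → sseq n = (stratA (hist2 ωA lam (n - 1))).2) →
        (∀ n, 1 ≤ n → tseq n = (stratB (hist2 ωA lam (n - 1)) (ωA n)).2) →
        (∀ n, 1 ≤ n → X (sseq n) (lam n) = ωA n) →
        (∀ n, 1 ≤ n → ωB n = X (tseq n) (lam n)) →
        ((∀ st ∈ ThetaF, ∀ N, ∃ n ≥ N, 1 ≤ n ∧ (sseq n, tseq n) = st) ∧
          ∀ KA KB : ℕ → ℝ, KA 0 = 1 → KB 0 = 1 →
            (∀ n, 1 ≤ n → KA n = KA (n - 1) *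
                (stratA (hist2 ωA lam (n - 1))).1 (sseq n) (ωA n) / (1 / 2)) →
            (∀ n, 1 ≤ n → KB n = KB (n - 1) *
                (stratB (hist2 ωA lam (n - 1)) (ωA n)).1 (tseq n) (ωB n) /
                (2 * chshP (ωA n) (ωB n) (sseq n) (tseq n))) →
            (Tendsto KA atTop atTop ∨ Tendsto KB atTop atTop ∨
              ∀ st ∈ ThetaF, ∀ a b : Sign,
                Tendsto (fun n =>
                    (((Finset.Icc 1 n).filter fun i =>
                        ωA i = a ∧ ωB i = b ∧ (sseq i, tseq i) = st).card : ℝ) /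
                    (((Finset.Icc 1 n).filter fun i => (sseq i, tseq i) = st).card : ℝ))
                  atTop (nhds (chshP a b st.1 st.2)))) := by
  refine ⟨fun h => (fun _ a => bet forecastA (phase h.length) (recordA h.reverse) a,
      settingA (phase h.length)),
    fun h ω => (fun _ b => bet forecastB (phase h.length, ω) (recordB X h.reverse) b,
      settingB (phase h.length)),
    fun h => ⟨settingA_mem (phase h.length), fun s _ =>
      isForecast_forecastA.bet_mem_Ioo_and_sum_bet _ (abs_le_one_of_mem_recordA _)⟩,
    fun h ω => ⟨settingB_mem (phase h.length), fun t _ =>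
      isForecast_forecastB.bet_mem_Ioo_and_sum_bet _ (abs_le_one_of_mem_recordB X _)⟩, ?_⟩
  intro ωA lam sseq tseq ωB hs ht _ hB
  simp only [length_hist2] at hs ht ⊢
  have hst : ∀ n, 1 ≤ n → ∀ j,
      (sseq n, tseq n) = (settingA j, settingB j) ↔ phase (n - 1) = j := by
    intro n hn j
    rw [hs n hn, ht n hn, settings_eq_iff]
  refine ⟨fun st hmem N => ?_, fun KA KB hKA0 hKB0 hKA hKB => ?_⟩
  · obtain ⟨j, rfl⟩ := exists_settings_eq hmem
    obtain ⟨n, hn, hj⟩ := exists_phase_eq j N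
    exact ⟨n + 1, by omega, by omega, (hst _ (by omega) j).mpr hj⟩
  set EA := fun n => recordA (hist2 ωA lam n).reverse with hEA_def
  set EB := fun n => recordB X (hist2 ωA lam n).reverse with hEB_def
  have hEA0 : EA 0 = [] := rfl
  have hEB0 : EB 0 = [] := rfl
  have hEA : ∀ n, EA (n + 1) = roundRecord forecastA (phase (n + 1 - 1)) (ωA (n + 1)) :: EA n := by
    intro n
    simp only [hEA_def, reverse_hist2_succ, recordA, List.length_reverse, length_hist2,
      Nat.add_sub_cancel]
  have hEB : ∀ n, EB (n + 1)
      = roundRecord forecastB (phase (n + 1 - 1), ωA (n + 1)) (ωB (n + 1)) :: EB n := by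
    intro n
    rw [hB _ (by omega), ht _ (by omega)]
    simp only [hEB_def, reverse_hist2_succ, recordB, List.length_reverse, length_hist2,
      Nat.add_sub_cancel]
  rcases isForecast_forecastA.capital_tendsto_atTop_or_frequency_tendsto
    (c := fun n => phase (n - 1)) hEA0 hEA with hA | hA
  · exact Or.inl (isForecast_forecastA.capital_tendsto_of_bet (c := fun n => phase (n - 1))
      hEA0 hEA hKA0 (fun n => hKA (n + 1) (by omega)) hA)
  rcases isForecast_forecastB.capital_tendsto_atTop_or_frequency_tendsto
    (c := fun n => (phase (n - 1), ωA n)) hEB0 hEB with hB' | hB'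
  · refine Or.inr (Or.inl (isForecast_forecastB.capital_tendsto_of_bet
      (c := fun n => (phase (n - 1), ωA n)) hEB0 hEB hKB0 (fun n => ?_) hB'))
    have h := hKB (n + 1) (by omega)
    rw [hs _ (by omega), ht _ (by omega)] at h
    exact h
  refine Or.inr (Or.inr fun st hmem a b => ?_)
  obtain ⟨j, rfl⟩ := exists_settings_eq hmem
  have hcount : Tendsto (fun n => ((Finset.Icc 1 n).filter fun i => phase (i - 1) = j).card)
      atTop atTop := tendsto_card_filter_atTop (exists_phase_eq j)
  have hlimA := hA j hcount a
  have hcount' : Tendsto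
      (fun n => ((Finset.Icc 1 n).filter fun i => (phase (i - 1), ωA i) = (j, a)).card)
      atTop atTop := by
    rw [← tendsto_natCast_atTop_iff (R := ℝ)]
    refine (((tendsto_natCast_atTop_atTop (R := ℝ)).comp hcount).atTop_mul_pos
      (by norm_num [forecastA]) hlimA).congr' ?_
    filter_upwards [hcount.eventually_gt_atTop 0] with n hn
    simp only [Function.comp_apply, Prod.mk.injEq]
    exact mul_div_cancel₀ _ (by exact_mod_cast hn.ne')
  have hlim := (hB' (j, a) hcount' b).mul hlimA
  have hval : forecastB (j, a) b * forecastA j a = chshP a b (settingA j) (settingB j) := by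
    simp only [forecastA, forecastB]
    ring
  rw [hval] at hlim
  refine hlim.congr' ?_
  filter_upwards [hcount'.eventually_gt_atTop 0] with n hn
  have h1 : ((Finset.Icc 1 n).filter fun i =>
      ωA i = a ∧ ωB i = b ∧ (sseq i, tseq i) = (settingA j, settingB j))
      = (Finset.Icc 1 n).filter fun i => (phase (i - 1), ωA i) = (j, a) ∧ ωB i = b := by
    refine Finset.filter_congr fun i hi => ?_
    rw [hst i (Finset.mem_Icc.mp hi).1, Prod.mk.injEq]
    tauto
  have h2 : ((Finset.Icc 1 n).filter fun i =>
      (sseq i, tseq i) = (settingA j, settingB j))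
      = (Finset.Icc 1 n).filter fun i => phase (i - 1) = j :=
    Finset.filter_congr fun i hi => hst i (Finset.mem_Icc.mp hi).1 j
  rw [h1, h2]
  simp only [Prod.mk.injEq] at hn ⊢
  exact div_mul_div_cancel₀ (by exact_mod_cast hn.ne')
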